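/- (Volterra's theorem) There do not exist two functions f, g : [0,1] → ℝ, each pointwise discontinuous (i.e., each having a dense set of continuity points), such that the set of continuity points of f equals the set of discontinuity points of g and the set of continuity points of g equals the set of discontinuity points of f. -/

import Mathlib

open Set Filter Topology

theorem dense_aux (f : ℝ → ℝ)
    (h : Set.Icc (0:ℝ) 1 ⊆
      closure {x ∈ Set.Icc (0:ℝ) 1 | ContinuousWithinAt f (Set.Icc 0 1) x}) :
    Dense {x : Set.Icc (0:ℝ) 1 | ContinuousAt ((Set.Icc (0:ℝ) 1).restrict f) x} := by
  rw [Subtype.dense_iff]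
  refine h.trans (closure_mono ?_)
  rintro x ⟨hx, hc⟩
  exact ⟨⟨x, hx⟩, (continuousWithinAt_iff_continuousAt_restrict f hx).1 hc, rfl⟩

/-- Volterra's theorem: there are no two pointwise discontinuous functions
`f, g : [0,1] → ℝ` (each with a dense set of continuity points) such that the continuity
points of one are exactly the discontinuity points of the other, and vice versa. -/
theorem volterra_theorem :
    ¬ ∃ f g : ℝ → ℝ,
      (Set.Icc (0:ℝ) 1 ⊆
        closure {x ∈ Set.Icc (0:ℝ) 1 | ContinuousWithinAt f (Set.Icc 0 1) x}) ∧
      (Set.Icc (0:ℝ) 1 ⊆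
        closure {x ∈ Set.Icc (0:ℝ) 1 | ContinuousWithinAt g (Set.Icc 0 1) x}) ∧
      ({x ∈ Set.Icc (0:ℝ) 1 | ContinuousWithinAt f (Set.Icc 0 1) x} =
        {x ∈ Set.Icc (0:ℝ) 1 | ¬ ContinuousWithinAt g (Set.Icc 0 1) x}) ∧
      ({x ∈ Set.Icc (0:ℝ) 1 | ContinuousWithinAt g (Set.Icc 0 1) x} =
        {x ∈ Set.Icc (0:ℝ) 1 | ¬ ContinuousWithinAt f (Set.Icc 0 1) x}) := by
  rintro ⟨f, g, hf, hg, h1, -⟩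
  obtain ⟨x, hxf, hxg⟩ := (Dense.inter_of_Gδ
    (IsGδ.setOfPred_continuousAt ((Set.Icc (0:ℝ) 1).restrict f))
    (IsGδ.setOfPred_continuousAt ((Set.Icc (0:ℝ) 1).restrict g))
    (dense_aux f hf) (dense_aux g hg)).nonempty
  have h2 : (x : ℝ) ∈ {x ∈ Set.Icc (0:ℝ) 1 | ContinuousWithinAt f (Set.Icc 0 1) x} :=
    ⟨x.2, (continuousWithinAt_iff_continuousAt_restrict f x.2).2 hxf⟩
  rw [h1] at h2
  exact h2.2 ((continuousWithinAt_iff_continuousAt_restrict g x.2).2 hxg)
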